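/- arXiv:2204.00813 — 2 statements merged into one kernel-verified Lean document; each statement's English description precedes it below -/
import Mathlib

section
/- In the smooth setting described below, the flow is conformal outside the support of the initial datum: for every z ∈ ℂ with ω₀(z) = 0 and every t ∈ [0,T], one has ∂̄X(t,z) = 0, where ∂̄ is the Wirtinger derivative in the space variable. -/
open MeasureTheory Complex ENNReal

/-- The Cauchy-type kernel `K(z) = e^{iθ}/(2πz)`. -/
noncomputable def Kker (θ : ℝ) (z : ℂ) : ℂ :=
  Complex.exp (θ * Complex.I) / (2 * Real.pi * z)

/-- The convolution `(K∗f)(x) = ∫ K(x−y) f(y) dA(y)` against Lebesgue measure on `ℂ`. -/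
noncomputable def Kconv (θ : ℝ) (f : ℂ → ℂ) (x : ℂ) : ℂ :=
  ∫ y, Kker θ (x - y) * f y

/-- The Wirtinger derivative `∂F = (∂_x F − i ∂_y F)/2` of `F : ℂ → ℂ` (real `fderiv`). -/
noncomputable def wdz (F : ℂ → ℂ) (z : ℂ) : ℂ :=
  (fderiv ℝ F z 1 - Complex.I * fderiv ℝ F z Complex.I) / 2

/-- The Wirtinger derivative `∂̄F = (∂_x F + i ∂_y F)/2` of `F : ℂ → ℂ` (real `fderiv`). -/
noncomputable def wdbar (F : ℂ → ℂ) (z : ℂ) : ℂ :=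
  (fderiv ℝ F z 1 + Complex.I * fderiv ℝ F z Complex.I) / 2

/-- The sup norm `‖g‖_∞ = sup_z |g z|` of a real valued function on `ℂ`. -/
noncomputable def supNorm (g : ℂ → ℝ) : ℝ := ⨆ z : ℂ, |g z|

/-- The smooth setting of Section 2: `θ ∈ [0,2π]`, `T > 0`, a smooth compactly supported
datum `ω₀`, a smooth compactly supported (in space) solution `ω` of the active scalar
equation `∂_t ω + v·∇ω = 0`, `v(t,·) = K∗ω(t,·)`, `ω(0,·) = ω₀`, and its smooth flow
`X` solving `∂_t X(t,z) = v(t,X(t,z))`, `X(0,z) = z`, where each `X(t,·)` is a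
bijective `C¹` map with everywhere positive Jacobian determinant. -/
structure SmoothSetting where
  θ : ℝ
  hθ : θ ∈ Set.Icc (0 : ℝ) (2 * Real.pi)
  T : ℝ
  hT : 0 < T
  ω₀ : ℂ → ℝ
  hω₀smooth : ContDiff ℝ (⊤ : ℕ∞) ω₀
  hω₀supp : HasCompactSupport ω₀
  ω : ℝ → ℂ → ℝ
  hωsmooth : ContDiff ℝ (⊤ : ℕ∞) (fun p : ℝ × ℂ => ω p.1 p.2)
  hωsupp : ∀ t : ℝ, HasCompactSupport (ω t)
  hωinit : ω 0 = ω₀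
  htransport : ∀ t ∈ Set.Icc (0 : ℝ) T, ∀ z : ℂ,
    deriv (fun s => ω s z) t
      + (Kconv θ (fun y => (ω t y : ℂ)) z).re * fderiv ℝ (ω t) z 1
      + (Kconv θ (fun y => (ω t y : ℂ)) z).im * fderiv ℝ (ω t) z Complex.I = 0
  X : ℝ → ℂ → ℂ
  hXsmooth : ContDiff ℝ (⊤ : ℕ∞) (fun p : ℝ × ℂ => X p.1 p.2)
  hXinit : ∀ z : ℂ, X 0 z = z
  hXflow : ∀ t ∈ Set.Icc (0 : ℝ) T, ∀ z : ℂ,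
    deriv (fun s => X s z) t = Kconv θ (fun y => (ω t y : ℂ)) (X t z)
  hXbij : ∀ t ∈ Set.Icc (0 : ℝ) T, Function.Bijective (X t)
  hXjac : ∀ t ∈ Set.Icc (0 : ℝ) T, ∀ z : ℂ,
    0 < LinearMap.det ((fderiv ℝ (X t) z) : ℂ →ₗ[ℝ] ℂ)

/-- In polar coordinates, `∂̄ = e^{iφ} (∂_r + (i/r) ∂_φ) / 2`. -/
lemma wdbar_eq_fderiv_mul (g : ℂ → ℂ) (z e : ℂ) :
    (starRingEnd ℂ) e * wdbar g z =
      (1 / 2 : ℂ) * (fderiv ℝ g z e + Complex.I * fderiv ℝ g z (Complex.I * e)) := by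
  have h : ∀ a b : ℝ, fderiv ℝ g z (a + b * Complex.I)
      = a * fderiv ℝ g z 1 + b * fderiv ℝ g z Complex.I := by
    intro a b
    have : (a + b * Complex.I : ℂ) = a • (1 : ℂ) + b • Complex.I := by simp
    rw [this, map_add, map_smul, map_smul, real_smul, real_smul]
  have h1 : Complex.I * e = ((-e.im : ℝ) : ℂ) + (e.re : ℝ) * Complex.I := by
    apply Complex.ext <;> simp
  have h2 : (starRingEnd ℂ) e = e.re - e.im * Complex.I := by
    apply Complex.ext <;> simp
  rw [h1, h]
  conv_rhs => rw [← Complex.re_add_im e]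
  rw [h, h2, wdbar]
  simp only [add_re, ofReal_re, mul_re, I_re, mul_zero, ofReal_im, I_im, mul_one, sub_self,
    add_zero, add_im, mul_im, zero_add, ofReal_neg]
  linear_combination (-(e.im : ℂ) / 2 * fderiv ℝ g z Complex.I) * Complex.I_sq

/-- A continuous function on the plane vanishing for large radius is integrable on the domain of
polar coordinates. -/
lemma integrableOn_polarCoord_target {G : ℝ × ℝ → ℂ} (hG : Continuous G) {R : ℝ}
    (hR : ∀ p : ℝ × ℝ, R < p.1 → G p = 0) :
    IntegrableOn G (Set.Ioi (0 : ℝ) ×ˢ Set.Ioo (-Real.pi) Real.pi)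
      ((volume : Measure ℝ).prod volume) := by
  have hK : IntegrableOn G (Set.Icc (0 : ℝ) R ×ˢ Set.Icc (-Real.pi) Real.pi)
      ((volume : Measure ℝ).prod volume) :=
    hG.continuousOn.integrableOn_compact (isCompact_Icc.prod isCompact_Icc)
  refine hK.of_forall_sdiff_eq_zero (measurableSet_Ioi.prod measurableSet_Ioo) ?_
  rintro ⟨r, φ⟩ ⟨⟨hr, hφ⟩, hn⟩
  apply hR
  by_contra! h
  exact hn ⟨⟨le_of_lt hr, h⟩, Set.Ioo_subset_Icc_self hφ⟩

/-- Integrating the radial derivative along a ray from the origin. -/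
lemma integral_Ioi_fderiv_radial {g : ℂ → ℂ} (hg : ContDiff ℝ 1 g) (hc : HasCompactSupport g)
    (e : ℂ) (he : ‖e‖ = 1) :
    ∫ r in Set.Ioi (0 : ℝ), fderiv ℝ g (r * e) e = - g 0 := by
  have hd : ∀ r : ℝ, HasDerivAt (fun r : ℝ => g (r * e)) (fderiv ℝ g (r * e) e) r := by
    intro r
    have h1 : HasDerivAt (fun r : ℝ => (r : ℂ) * e) e r := by
      simpa using (Complex.ofRealCLM.hasDerivAt (x := r)).mul_const e
    exact ((hg.differentiable one_ne_zero) (r * e)).hasFDerivAt.comp_hasDerivAt r h1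
  have hcs : HasCompactSupport (fun r : ℝ => g (r * e)) := by
    obtain ⟨R, hR⟩ := hc.isCompact.isBounded.subset_closedBall 0
    refine HasCompactSupport.intro (isCompact_Icc (a := -R) (b := R)) fun r hr => ?_
    apply image_eq_zero_of_notMem_tsupport
    intro h
    have := hR h
    rw [mem_closedBall_zero_iff, norm_mul, he, mul_one, Complex.norm_real, Real.norm_eq_abs,
      abs_le] at this
    exact hr this
  have hderiv : deriv (fun r : ℝ => g (r * e)) = fun r : ℝ => fderiv ℝ g (r * e) e :=
    funext fun r => (hd r).deriv
  have : ∫ r in Set.Ioi (0 : ℝ), deriv (fun r : ℝ => g (r * e)) r = - g ((0 : ℝ) * e) :=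
    hcs.integral_Ioi_deriv_eq (hg.comp (Complex.ofRealCLM.contDiff.mul contDiff_const)) 0
  rw [hderiv] at this
  simpa using this

/-- The angular derivative has zero mean on every circle centred at the origin. -/
lemma integral_Ioo_fderiv_angular {g : ℂ → ℂ} (hg : ContDiff ℝ 1 g) {r : ℝ} (hr : r ≠ 0) :
    ∫ φ in Set.Ioo (-Real.pi) Real.pi,
      fderiv ℝ g (r * Complex.exp (φ * Complex.I)) (Complex.I * Complex.exp (φ * Complex.I))
        = 0 := by
  have hd : ∀ φ : ℝ, HasDerivAt (fun φ : ℝ => r⁻¹ • g (r * Complex.exp (φ * Complex.I)))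
      (fderiv ℝ g (r * Complex.exp (φ * Complex.I)) (Complex.I * Complex.exp (φ * Complex.I)))
      φ := by
    intro φ
    have h1 : HasDerivAt (fun φ : ℝ => (r : ℂ) * Complex.exp (φ * Complex.I))
        (r • (Complex.I * Complex.exp (φ * Complex.I))) φ := by
      have := (((Complex.ofRealCLM.hasDerivAt (x := φ)).mul_const Complex.I).cexp).const_mul (r : ℂ)
      refine this.congr_deriv ?_
      rw [real_smul, Complex.ofRealCLM_apply, Complex.ofRealCLM_apply,
        Complex.ofReal_one]
      ring
    have h2 := (((hg.differentiable one_ne_zero) _).hasFDerivAt.comp_hasDerivAt φ h1).const_smul r⁻¹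
    refine h2.congr_deriv ?_
    rw [map_smul, smul_smul, inv_mul_cancel₀ hr, one_smul]
  have hcont : Continuous fun φ : ℝ => fderiv ℝ g (r * Complex.exp (φ * Complex.I))
      (Complex.I * Complex.exp (φ * Complex.I)) := by
    have := hg.continuous_fderiv one_ne_zero
    fun_prop
  rw [← integral_Ioc_eq_integral_Ioo,
    ← intervalIntegral.integral_of_le (by linarith [Real.pi_pos]),
    intervalIntegral.integral_eq_sub_of_hasDerivAt (fun φ _ => hd φ)
      (hcont.intervalIntegrable _ _)]
  have : Complex.exp (((-Real.pi : ℝ) : ℂ) * Complex.I) = Complex.exp (Real.pi * Complex.I) := by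
    rw [Complex.exp_pi_mul_I, ofReal_neg, neg_mul, Complex.exp_neg, Complex.exp_pi_mul_I]
    norm_num
  rw [this, sub_self]

/-- The Cauchy–Pompeiu formula for compactly supported functions on the plane. -/
lemma integral_inv_mul_wdbar {g : ℂ → ℂ} (hg : ContDiff ℝ 1 g) (hc : HasCompactSupport g) :
    ∫ y, y⁻¹ * wdbar g y = - (Real.pi * g 0) := by
  have hcf := hg.continuous_fderiv one_ne_zero
  let A : ℝ × ℝ → ℂ := fun p =>
    fderiv ℝ g (p.1 * Complex.exp (p.2 * Complex.I)) (Complex.exp (p.2 * Complex.I))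
  let B : ℝ × ℝ → ℂ := fun p =>
    fderiv ℝ g (p.1 * Complex.exp (p.2 * Complex.I))
      (Complex.I * Complex.exp (p.2 * Complex.I))
  have hA : Continuous A := by fun_prop
  have hB : Continuous B := by fun_prop
  obtain ⟨R, hR⟩ := (hc.fderiv ℝ).isCompact.isBounded.subset_closedBall 0
  have hz : ∀ p : ℝ × ℝ, R < p.1 → fderiv ℝ g (p.1 * Complex.exp (p.2 * Complex.I)) = 0 := by
    intro p hp
    apply image_eq_zero_of_notMem_tsupport
    intro h
    have := hR h
    rw [mem_closedBall_zero_iff, norm_mul, Complex.norm_exp_ofReal_mul_I, mul_one,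
      Complex.norm_real, Real.norm_eq_abs] at this
    linarith [le_abs_self p.1]
  have hAi := integrableOn_polarCoord_target hA (R := R) fun p hp => by simp [A, hz p hp]
  have hBi := integrableOn_polarCoord_target hB (R := R) fun p hp => by simp [B, hz p hp]
  have hA0 : ∫ p in Set.Ioi (0 : ℝ) ×ˢ Set.Ioo (-Real.pi) Real.pi, A p
      = - (2 * Real.pi * g 0) := by
    rw [Measure.volume_eq_prod, ← setIntegral_prod_swap, 
      setIntegral_prod (fun p : ℝ × ℝ => A p.swap) hAi.swap]
    have : ∀ φ : ℝ, ∫ r in Set.Ioi (0 : ℝ), A (Prod.swap (φ, r)) = - g 0 := fun φ =>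
      integral_Ioi_fderiv_radial hg hc _ (Complex.norm_exp_ofReal_mul_I φ)
    simp only [this, integral_const, real_smul]
    have hvol : (volume.restrict (Set.Ioo (-Real.pi) Real.pi)).real Set.univ
        = 2 * Real.pi := by
      rw [measureReal_restrict_apply_univ,
        Real.volume_real_Ioo_of_le (by linarith [Real.pi_pos])]
      ring
    rw [hvol]
    push_cast
    ring
  have hB0 : ∫ p in Set.Ioi (0 : ℝ) ×ˢ Set.Ioo (-Real.pi) Real.pi, B p = 0 := by
    rw [Measure.volume_eq_prod, setIntegral_prod _ hBi]
    exact setIntegral_eq_zero_of_forall_eq_zero fun r hr =>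
      integral_Ioo_fderiv_angular hg (ne_of_gt hr)
  rw [← Complex.integral_comp_polarCoord_symm]
  have key : ∀ p ∈ polarCoord.target,
      p.1 • ((Complex.polarCoord.symm p)⁻¹ * wdbar g (Complex.polarCoord.symm p))
        = (1 / 2 : ℂ) * (A p + Complex.I * B p) := by
    rintro p ⟨hp, -⟩
    have hp0 : (p.1 : ℂ) ≠ 0 := by exact_mod_cast (ne_of_gt hp)
    have hs : Complex.polarCoord.symm p = p.1 * Complex.exp (p.2 * Complex.I) := by
      rw [Complex.polarCoord_symm_apply, Complex.exp_mul_I, ofReal_cos, ofReal_sin]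
    have hinv : (Complex.exp (p.2 * Complex.I))⁻¹
        = (starRingEnd ℂ) (Complex.exp (p.2 * Complex.I)) :=
      Complex.inv_eq_conj (Complex.norm_exp_ofReal_mul_I _)
    rw [hs, ← wdbar_eq_fderiv_mul, ← hinv, real_smul, mul_inv]
    field_simp
  rw [setIntegral_congr_fun polarCoord.open_target.measurableSet key, polarCoord_target,
    Measure.volume_eq_prod, integral_const_mul, integral_add hAi (hBi.const_mul _),
    integral_const_mul, ← Measure.volume_eq_prod, hA0, hB0]
  ring

lemma locallyIntegrable_Kker (θ : ℝ) : LocallyIntegrable (Kker θ) volume := by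
  refine locallyIntegrable_of_norm_le_rpow (C := (2 * Real.pi)⁻¹) (α := 1) ?_ ?_ ?_ ?_
  · simp [Complex.finrank_real_complex]
  · simp [Complex.finrank_real_complex]
  · refine .of_forall fun x => ?_
    rw [Kker, norm_div, Complex.norm_exp_ofReal_mul_I, Real.rpow_neg_one, norm_mul, norm_mul,
      Complex.norm_real, Real.norm_of_nonneg Real.pi_pos.le, one_div, mul_inv]
    simp
  · have : Measurable (Kker θ) := by
      unfold Kker
      fun_prop
    exact this.aestronglyMeasurable

/-- The kernel `K` is, up to the factor `e^{iθ}/2`, the fundamental solution of `∂̄`. -/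
lemma differentiable_Kconv (θ : ℝ) {f : ℂ → ℂ} (hf : ContDiff ℝ 1 f) (hc : HasCompactSupport f) :
    Differentiable ℝ (Kconv θ f) ∧
      ∀ x, wdbar (Kconv θ f) x = Complex.exp (θ * Complex.I) / 2 * f x := by
  have hconv : Kconv θ f =
      convolution (Kker θ) f (ContinuousLinearMap.mul ℝ ℂ) volume := by
    ext x
    rw [convolution_eq_swap]
    rfl
  have hL := locallyIntegrable_Kker θ
  have hD := fun x => hc.hasFDerivAt_convolution_right (ContinuousLinearMap.mul ℝ ℂ) hL hf x
  rw [← hconv] at hD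
  refine ⟨fun x => (hD x).differentiableAt, fun x => ?_⟩
  have happ : ∀ e : ℂ, Integrable (fun y => Kker θ y * fderiv ℝ f (x - y) e) ∧
      fderiv ℝ (Kconv θ f) x e = ∫ y, Kker θ y * fderiv ℝ f (x - y) e := by
    intro e
    have hcf := hf.continuous_fderiv one_ne_zero
    have hce := hc.fderiv_apply (𝕜 := ℝ) e
    constructor
    · exact hce.convolutionExists_right (ContinuousLinearMap.mul ℝ ℂ) hL (by fun_prop) x
    · rw [(hD x).fderiv, convolution_precompR_apply _ hL (hc.fderiv ℝ) hcf]
      rfl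
  have hgd : ∀ y, fderiv ℝ (fun y => f (x - y)) y = -fderiv ℝ f (x - y) := by
    intro y
    have : fderiv ℝ (fun y => f (x - y)) y = _ :=
      ((hf.differentiable one_ne_zero (x - y)).hasFDerivAt.comp y
        ((hasFDerivAt_id y).const_sub x)).fderiv
    ext e
    simpa using congrArg (fun L : ℂ →L[ℝ] ℂ => L e) this
  have hp := integral_inv_mul_wdbar (g := fun y => f (x - y))
    (hf.comp (contDiff_const.sub contDiff_id))
    (hc.comp_homeomorph (Homeomorph.subLeft x))
  simp only [sub_zero] at hp
  have hpi : (Real.pi : ℂ) ≠ 0 := by exact_mod_cast Real.pi_ne_zero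
  calc wdbar (Kconv θ f) x
      = (∫ y, Kker θ y * (fderiv ℝ f (x - y) 1
          + Complex.I * fderiv ℝ f (x - y) Complex.I)) / 2 := by
        rw [wdbar, (happ 1).2, (happ Complex.I).2, ← integral_const_mul,
          ← integral_add (happ 1).1 ((happ _).1.const_mul _)]
        congr 2 with y
        ring
    _ = - (Complex.exp (θ * Complex.I) / (2 * Real.pi)) *
          ∫ y, y⁻¹ * wdbar (fun y => f (x - y)) y := by
        rw [← integral_const_mul, ← integral_div]
        congr 1 with y
        simp only [wdbar, hgd, Kker, neg_apply]
        rw [div_mul_eq_div_div, div_eq_mul_inv _ y]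
        ring
    _ = _ := by
        rw [hp]
        field_simp

namespace SmoothSetting

/-- The velocity is differentiable in space, with `∂̄v = e^{iθ} ω / 2`. -/
lemma differentiable_velocity (S : SmoothSetting) (t : ℝ) :
    Differentiable ℝ (Kconv S.θ (fun y => (S.ω t y : ℂ))) ∧
      ∀ x, wdbar (Kconv S.θ (fun y => (S.ω t y : ℂ))) x
        = Complex.exp (S.θ * Complex.I) / 2 * S.ω t x := by
  have hω : ContDiff ℝ 1 (S.ω t) :=
    (S.hωsmooth.comp (contDiff_const.prodMk contDiff_id)).of_le (by norm_cast)
  exact differentiable_Kconv S.θ (Complex.ofRealCLM.contDiff.comp hω)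
    ((S.hωsupp t).comp_left (g := ((↑) : ℝ → ℂ)) Complex.ofReal_zero)

/-- The active scalar is transported by the flow. -/
lemma ω_comp_X (S : SmoothSetting) (z : ℂ) {t : ℝ} (ht : t ∈ Set.Icc 0 S.T) :
    S.ω t (S.X t z) = S.ω₀ z := by
  have hder : ∀ s ∈ Set.Icc 0 S.T, HasDerivAt (fun s => S.ω s (S.X s z)) 0 s := by
    intro s hs
    have hω := (S.hωsmooth.differentiable (by simp) (s, S.X s z)).hasFDerivAt
    have hX : DifferentiableAt ℝ (fun s => S.X s z) s :=
      (S.hXsmooth.comp (contDiff_id.prodMk contDiff_const)).differentiable (by simp) s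
    have hX' := hX.hasDerivAt
    rw [S.hXflow s hs] at hX'
    set v := Kconv S.θ (fun y => (S.ω s y : ℂ)) (S.X s z) with hv
    have htot := hω.comp_hasDerivAt s ((hasDerivAt_id s).prodMk hX')
    have ht1 : HasDerivAt (fun r => S.ω r (S.X s z)) _ s :=
      HasFDerivAt.comp_hasDerivAt (f := fun r : ℝ => (r, S.X s z)) s hω
        ((hasDerivAt_id s).prodMk (hasDerivAt_const s (S.X s z)))
    have ht2 : HasFDerivAt (S.ω s) _ (S.X s z) :=
      HasFDerivAt.comp (f := fun w => (s, w)) (S.X s z) hω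
        (hasFDerivAt_prodMk_right s (S.X s z))
    have htr := S.htransport s hs (S.X s z)
    rw [ht1.deriv, ht2.fderiv, ← hv] at htr
    refine htot.congr_deriv ?_
    rw [← htr]
    set D := fderiv ℝ (fun p : ℝ × ℂ => S.ω p.1 p.2) (s, S.X s z)
    have hdec : ((1 : ℝ), v) = (1, 0) + (v.re • ((0 : ℝ), (1 : ℂ)) + v.im • (0, Complex.I)) := by
      ext <;> simp
    rw [hdec, map_add, map_add, map_smul, map_smul]
    simp [add_assoc]
  have h := constant_of_has_deriv_right_zero
    (fun s hs => (hder s hs).continuousAt.continuousWithinAt)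
    (fun s hs => (hder s (Set.Ico_subset_Icc_self hs)).hasDerivWithinAt) t ht
  simpa [S.hXinit, S.hωinit] using h

/-- The equation of variations: the spatial derivative of the flow satisfies
`∂_t (DX e) = Dv (DX e)`. -/
lemma hasDerivAt_fderiv_X (S : SmoothSetting) (z e : ℂ) {t : ℝ} (ht : t ∈ Set.Icc 0 S.T) :
    HasDerivAt (fun s => fderiv ℝ (S.X s) z e)
      (fderiv ℝ (Kconv S.θ (fun y => (S.ω t y : ℂ))) (S.X t z) (fderiv ℝ (S.X t) z e)) t := by
  set F : ℝ × ℂ → ℂ := fun p => S.X p.1 p.2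
  have hFs : ContDiff ℝ (⊤ : ℕ∞) F := S.hXsmooth
  have hFd : Differentiable ℝ F := hFs.differentiable (by simp)
  have hF'd : Differentiable ℝ (fderiv ℝ F) :=
    (hFs.fderiv_right (m := 1) (by norm_cast)).differentiable one_ne_zero
  have hsp : ∀ s w, HasFDerivAt (S.X s) ((fderiv ℝ F (s, w)).comp (.inr ℝ ℝ ℂ)) w := fun s w =>
    HasFDerivAt.comp w (hFd (s, w)).hasFDerivAt (hasFDerivAt_prodMk_right s w)
  have htm : ∀ s w, HasDerivAt (fun s => S.X s w) (fderiv ℝ F (s, w) (1, 0)) s := fun s w =>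
    HasFDerivAt.comp_hasDerivAt (f := fun r : ℝ => (r, w)) s (hFd (s, w)).hasFDerivAt
      ((hasDerivAt_id s).prodMk (hasDerivAt_const s w))
  have hv : Differentiable ℝ (Kconv S.θ (fun y => (S.ω t y : ℂ))) :=
    (S.differentiable_velocity t).1
  have h2 : HasDerivAt (fun s => fderiv ℝ F (s, z)) (fderiv ℝ (fderiv ℝ F) (t, z) (1, 0)) t :=
    (hF'd (t, z)).hasFDerivAt.comp_hasDerivAt t ((hasDerivAt_id t).prodMk (hasDerivAt_const t z))
  have h3 : HasDerivAt (fun s => fderiv ℝ (S.X s) z e)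
      (fderiv ℝ (fderiv ℝ F) (t, z) (1, 0) (0, e)) t := by
    have := h2.clm_apply (hasDerivAt_const t ((0 : ℝ), e))
    simp only [map_zero, add_zero] at this
    refine this.congr_of_eventuallyEq (.of_forall fun s => ?_)
    simp [(hsp s z).fderiv]
  refine h3.congr_deriv ?_
  have hsymm : IsSymmSndFDerivAt ℝ F (t, z) :=
    hFs.contDiffAt.isSymmSndFDerivAt (by simp; norm_cast)
  rw [hsymm.eq]
  have h4 : HasFDerivAt (fun w => fderiv ℝ F (t, w))
      ((fderiv ℝ (fderiv ℝ F) (t, z)).comp (.inr ℝ ℝ ℂ)) z :=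
    HasFDerivAt.comp z (hF'd (t, z)).hasFDerivAt (hasFDerivAt_prodMk_right t z)
  have h5 := h4.clm_apply (hasFDerivAt_const ((1 : ℝ), (0 : ℂ)) z)
  have h6 : (fun w => fderiv ℝ F (t, w) (1, 0))
      = fun w => Kconv S.θ (fun y => (S.ω t y : ℂ)) (S.X t w) := by
    ext w
    rw [← (htm t w).deriv, S.hXflow t ht]
  rw [h6] at h5
  have h7 := (hv (S.X t z)).hasFDerivAt.comp z (hsp t z).differentiableAt.hasFDerivAt
  have := congrArg (fun L : ℂ →L[ℝ] ℂ => L e) (h5.unique h7)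
  simpa using this

end SmoothSetting

/-- in the smooth setting, the flow is conformal outside of the support
of the initial datum: if `ω₀(z) = 0` then `∂̄X(t,z) = 0` for all `t ∈ [0,T]`. -/
theorem flow_conformal_outside_support (S : SmoothSetting) :
    ∀ z : ℂ, S.ω₀ z = 0 → ∀ t ∈ Set.Icc (0 : ℝ) S.T, wdbar (S.X t) z = 0 := by
  intro z hz t ht
  set p : ℝ → ℂ := fun s => fderiv ℝ (S.X s) z 1 with hp
  set q : ℝ → ℂ := fun s => fderiv ℝ (S.X s) z Complex.I with hq
  have hp0 : ∀ s ∈ Set.Icc 0 S.T, p s ≠ 0 := by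
    intro s hs h
    have hdet := (S.hXjac s hs z).ne'
    have hinj := (LinearMap.isUnit_iff_ker_eq_bot _).1
      ((LinearMap.isUnit_iff_isUnit_det _).2 (isUnit_iff_ne_zero.2 hdet))
    exact one_ne_zero (LinearMap.ker_eq_bot'.1 hinj 1 h)
  have hder : ∀ s ∈ Set.Icc 0 S.T, HasDerivAt (fun s => q s / p s) 0 s := by
    intro s hs
    set D := fderiv ℝ (Kconv S.θ (fun y => (S.ω s y : ℂ))) (S.X s z) with hD
    have hwd : wdbar (Kconv S.θ (fun y => (S.ω s y : ℂ))) (S.X s z) = 0 := by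
      rw [(S.differentiable_velocity s).2, S.ω_comp_X z hs, hz]
      simp
    have hlin : ∀ w, D w = D 1 * w := by
      intro w
      have hI : D Complex.I = Complex.I * D 1 := by
        rw [wdbar, ← hD] at hwd
        linear_combination (-2 * Complex.I) * hwd + D Complex.I * Complex.I_sq
      have hw : w = w.re • (1 : ℂ) + w.im • Complex.I := by simp
      conv_lhs => rw [hw, map_add, map_smul, map_smul, hI, real_smul, real_smul]
      conv_rhs => rw [← Complex.re_add_im w]
      ring
    have h1 := S.hasDerivAt_fderiv_X z 1 hs
    have h2 := S.hasDerivAt_fderiv_X z Complex.I hs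
    rw [← hD, hlin] at h1 h2
    refine (h2.div h1 (hp0 s hs)).congr_deriv ?_
    exact (congrArg (· / p s ^ 2) (by ring)).trans (zero_div _)
  have h := constant_of_has_deriv_right_zero
    (fun s hs => (hder s hs).continuousAt.continuousWithinAt)
    (fun s hs => (hder s (Set.Ico_subset_Icc_self hs)).hasDerivWithinAt) t ht
  have hX0 : S.X 0 = id := funext S.hXinit
  simp only [hp, hq, hX0, fderiv_id, ContinuousLinearMap.id_apply, div_one] at h
  rw [div_eq_iff (hp0 t ht)] at h
  rw [wdbar, h, ← mul_assoc, Complex.I_mul_I]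
  ring
end

section
/- Velocity formulation implies vorticity formulation: let T > 0, θ ∈ [0,2π], let v : [0,T] × ℝ² → ℝ² be smooth, bounded, with bounded first-order spatial derivatives uniformly in t, and let q : [0,T] × ℝ² → ℝ be smooth, satisfying ∂_t v + (v·∇)v = −M_θ ∇q, −Δq = div(v) · div(M_θ v), curl(M_θ v)(0,·) = 0 and div(M_θ v)(0,·) = ω₀ for a given smooth compactly supported ω₀ : ℝ² → ℝ. Then curl(M_θ v)(t,·) = 0 for every t ∈ [0,T], and the function ω := div(M_θ v) satisfies the transport equation ∂_t ω + v·∇ω = 0 on [0,T] × ℝ² with ω(0,·) = ω₀. -/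
open MeasureTheory Complex ENNReal

/-- The `ℝ`-linear map `M_θ z = e^{iθ} z̄`, i.e. the matrix
`[[cos θ, sin θ],[sin θ, −cos θ]]` acting on `ℝ² ≅ ℂ`. -/
noncomputable def Mθ (θ : ℝ) (z : ℂ) : ℂ :=
  Complex.exp (θ * Complex.I) * (starRingEnd ℂ z)

/-- Divergence `div w = ∂_x w₁ + ∂_y w₂` of a planar vector field `w : ℂ → ℂ`. -/
noncomputable def divOp (w : ℂ → ℂ) (z : ℂ) : ℝ :=
  (fderiv ℝ w z 1).re + (fderiv ℝ w z Complex.I).im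

/-- Curl `curl w = ∂_x w₂ − ∂_y w₁` of a planar vector field `w : ℂ → ℂ`. -/
noncomputable def curlOp (w : ℂ → ℂ) (z : ℂ) : ℝ :=
  (fderiv ℝ w z 1).im - (fderiv ℝ w z Complex.I).re

/-- The gradient `∇q = (∂_x q, ∂_y q)` of a scalar function, viewed as a point of `ℂ`. -/
noncomputable def gradC (q : ℂ → ℝ) (z : ℂ) : ℂ :=
  (fderiv ℝ q z 1 : ℂ) + Complex.I * (fderiv ℝ q z Complex.I : ℂ)

/-- The Laplacian `Δq = ∂_xx q + ∂_yy q` of a scalar function on `ℂ ≅ ℝ²`. -/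
noncomputable def lapl (q : ℂ → ℝ) (z : ℂ) : ℝ :=
  fderiv ℝ (fun w => fderiv ℝ q w 1) z 1
    + fderiv ℝ (fun w => fderiv ℝ q w Complex.I) z Complex.I

/-- The convective derivative `(v·∇)w = v₁ ∂_x w + v₂ ∂_y w`. -/
noncomputable def convDeriv (v w : ℂ → ℂ) (z : ℂ) : ℂ :=
  (v z).re • fderiv ℝ w z 1 + (v z).im • fderiv ℝ w z Complex.I

/-- The Wirtinger derivative `2 ∂_z̄ v = ∂_x v + i ∂_y v` in the space variable. -/
noncomputable def wirt (F : ℝ × ℂ → ℂ) (p : ℝ × ℂ) : ℂ :=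
  fderiv ℝ F p (0, 1) + Complex.I * fderiv ℝ F p (0, Complex.I)

lemma hasDerivAt_line {E : Type*} [NormedAddCommGroup E] [NormedSpace ℝ E] {G : ℝ × ℂ → E}
    {p : ℝ × ℂ} (hG : DifferentiableAt ℝ G p) (a : ℝ × ℂ) :
    HasDerivAt (fun r : ℝ => G (p + r • a)) (fderiv ℝ G p a) 0 := by
  have h : HasDerivAt (fun r : ℝ => p + r • a) a 0 := by
    simpa using ((hasDerivAt_id (0 : ℝ)).smul_const a).const_add p
  have hG' : HasFDerivAt G (fderiv ℝ G p) (p + (0 : ℝ) • a) := by simpa using hG.hasFDerivAt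
  exact hG'.comp_hasDerivAt 0 h

lemma hasDerivAt_time_slice {E : Type*} [NormedAddCommGroup E] [NormedSpace ℝ E] {G : ℝ × ℂ → E}
    {t : ℝ} {z : ℂ} (hG : DifferentiableAt ℝ G (t, z)) :
    HasDerivAt (fun s => G (s, z)) (fderiv ℝ G (t, z) (1, 0)) t :=
  hG.hasFDerivAt.comp_hasDerivAt (f := fun s : ℝ => (s, z)) t
    ((hasDerivAt_id t).prodMk (hasDerivAt_const t z))

lemma fderiv_space_slice {E : Type*} [NormedAddCommGroup E] [NormedSpace ℝ E] {G : ℝ × ℂ → E}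
    {t : ℝ} {z : ℂ} (hG : DifferentiableAt ℝ G (t, z)) (h : ℂ) :
    fderiv ℝ (fun w => G (t, w)) z h = fderiv ℝ G (t, z) (0, h) := by
  have := hG.hasFDerivAt.comp (f := fun w : ℂ => (t, w)) z
    ((hasFDerivAt_const t z).prodMk (hasFDerivAt_id z))
  rw [HasFDerivAt.fderiv (f := fun w => G (t, w)) this]
  simp

/-- `M_θ` as a continuous `ℝ`-linear map. -/
noncomputable def MθCLM (θ : ℝ) : ℂ →L[ℝ] ℂ :=
  (ContinuousLinearMap.mul ℝ ℂ (Complex.exp (θ * Complex.I))).comp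
    (Complex.conjCLE : ℂ →L[ℝ] ℂ)

lemma MθCLM_apply (θ : ℝ) (z : ℂ) : MθCLM θ z = Mθ θ z := by
  simp [MθCLM, Mθ]

lemma fderiv_Mθ_space_slice (θ : ℝ) {F : ℝ × ℂ → ℂ} {t : ℝ} {z : ℂ}
    (hF : DifferentiableAt ℝ F (t, z)) (h : ℂ) :
    fderiv ℝ (fun w => Mθ θ (F (t, w))) z h = Mθ θ (fderiv ℝ F (t, z) (0, h)) := by
  have h1 : DifferentiableAt ℝ (fun p => MθCLM θ (F p)) (t, z) :=
    (MθCLM θ).differentiableAt.comp _ hF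
  have h2 := fderiv_space_slice h1 h
  have h3 : fderiv ℝ (fun p => MθCLM θ (F p)) (t, z) = (MθCLM θ).comp (fderiv ℝ F (t, z)) :=
    ((MθCLM θ).hasFDerivAt.comp _ hF.hasFDerivAt).fderiv
  rw [h3] at h2
  simpa only [MθCLM_apply, ContinuousLinearMap.comp_apply] using h2

lemma divOp_Mθ (θ : ℝ) {F : ℝ × ℂ → ℂ} {t : ℝ} {z : ℂ} (hF : DifferentiableAt ℝ F (t, z)) :
    divOp (fun w => Mθ θ (F (t, w))) z = (Mθ θ (wirt F (t, z))).re := by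
  simp only [divOp, fderiv_Mθ_space_slice θ hF]
  simp only [wirt, Mθ]
  simp
  ring

lemma curlOp_Mθ (θ : ℝ) {F : ℝ × ℂ → ℂ} {t : ℝ} {z : ℂ} (hF : DifferentiableAt ℝ F (t, z)) :
    curlOp (fun w => Mθ θ (F (t, w))) z = (Mθ θ (wirt F (t, z))).im := by
  simp only [curlOp, fderiv_Mθ_space_slice θ hF]
  simp only [wirt, Mθ]
  simp
  ring

lemma Mθ_Mθ (θ : ℝ) (z : ℂ) : Mθ θ (Mθ θ z) = z := by
  simp only [Mθ, map_mul, Complex.conj_conj, ← Complex.exp_conj, ← mul_assoc, ← Complex.exp_add]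
  simp

section Smooth

variable {E : Type*} [NormedAddCommGroup E] [NormedSpace ℝ E] {F : ℝ × ℂ → E}

lemma contDiff_fderiv_apply_const (hF : ContDiff ℝ (⊤ : ℕ∞) F) (a : ℝ × ℂ) :
    ContDiff ℝ (⊤ : ℕ∞) (fun p => fderiv ℝ F p a) :=
  (hF.fderiv_right (m := (⊤ : ℕ∞)) (by simp)).clm_apply contDiff_const

lemma fderiv_fderiv_apply_comm (hF : ContDiff ℝ (⊤ : ℕ∞) F) (p a b : ℝ × ℂ) :
    fderiv ℝ (fun p => fderiv ℝ F p a) p b = fderiv ℝ (fun p => fderiv ℝ F p b) p a := by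
  have hd : DifferentiableAt ℝ (fderiv ℝ F) p :=
    (hF.fderiv_right (m := (⊤ : ℕ∞)) (by simp)).differentiable (by simp) p
  have key (c d : ℝ × ℂ) :
      fderiv ℝ (fun p => fderiv ℝ F p c) p d = fderiv ℝ (fderiv ℝ F) p d c := by
    rw [fderiv_clm_apply hd (by fun_prop)]
    simp
  rw [key, key]
  have hs : IsSymmSndFDerivAt ℝ F p :=
    hF.contDiffAt.isSymmSndFDerivAt (by
      rw [minSmoothness_of_isRCLikeNormedField]; exact WithTop.coe_le_coe.2 le_top)
  exact hs b a

end Smooth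

section Wirtinger

variable {F : ℝ × ℂ → ℂ}

lemma contDiff_wirt (hF : ContDiff ℝ (⊤ : ℕ∞) F) : ContDiff ℝ (⊤ : ℕ∞) (wirt F) :=
  (contDiff_fderiv_apply_const hF _).add
    (contDiff_const.mul (contDiff_fderiv_apply_const hF _))

lemma fderiv_wirt (hF : ContDiff ℝ (⊤ : ℕ∞) F) (p d : ℝ × ℂ) :
    fderiv ℝ (wirt F) p d = fderiv ℝ (fun p => fderiv ℝ F p (0, 1)) p d
      + Complex.I * fderiv ℝ (fun p => fderiv ℝ F p (0, Complex.I)) p d := by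
  have hd (a : ℝ × ℂ) : HasFDerivAt (fun p => fderiv ℝ F p a) _ p :=
    ((contDiff_fderiv_apply_const hF a).differentiable (by simp) p).hasFDerivAt
  have h : HasFDerivAt (wirt F) _ p := (hd (0, 1)).add ((hd (0, Complex.I)).const_mul Complex.I)
  rw [h.fderiv]
  simp

/-- Differentiating the momentum equation in space. -/
lemma fderiv_momentum {θ t : ℝ} {Q : ℝ × ℂ → ℝ} (hF : ContDiff ℝ (⊤ : ℕ∞) F)
    (hQ : ContDiff ℝ (⊤ : ℕ∞) Q)
    (hmom : ∀ z, fderiv ℝ F (t, z) (1, 0) + ((F (t, z)).re • fderiv ℝ F (t, z) (0, 1)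
      + (F (t, z)).im • fderiv ℝ F (t, z) (0, Complex.I))
      = - Mθ θ ((fderiv ℝ Q (t, z) (0, 1) : ℂ)
        + Complex.I * (fderiv ℝ Q (t, z) (0, Complex.I) : ℂ))) (z h : ℂ) :
    fderiv ℝ (fun p => fderiv ℝ F p (1, 0)) (t, z) (0, h)
      + (((F (t, z)).re • fderiv ℝ (fun p => fderiv ℝ F p (0, 1)) (t, z) (0, h)
        + (fderiv ℝ F (t, z) (0, h)).re • fderiv ℝ F (t, z) (0, 1))
      + ((F (t, z)).im • fderiv ℝ (fun p => fderiv ℝ F p (0, Complex.I)) (t, z) (0, h)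
        + (fderiv ℝ F (t, z) (0, h)).im • fderiv ℝ F (t, z) (0, Complex.I)))
      = - Mθ θ ((fderiv ℝ (fun p => fderiv ℝ Q p (0, 1)) (t, z) (0, h) : ℂ)
        + Complex.I * (fderiv ℝ (fun p => fderiv ℝ Q p (0, Complex.I)) (t, z) (0, h) : ℂ)) := by
  have hF1 (a : ℝ × ℂ) := hasDerivAt_line
    ((contDiff_fderiv_apply_const hF a).differentiable (by simp) (t, z)) (0, h)
  have hQ1 (a : ℝ × ℂ) := (hasDerivAt_line
    ((contDiff_fderiv_apply_const hQ a).differentiable (by simp) (t, z)) (0, h)).ofReal_comp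
  have hF0 := hasDerivAt_line (hF.differentiable (by simp) (t, z)) (0, h)
  have hre := Complex.reCLM.hasFDerivAt.comp_hasDerivAt (0 : ℝ) hF0
  have him := Complex.imCLM.hasFDerivAt.comp_hasDerivAt (0 : ℝ) hF0
  have hL := (hF1 (1, 0)).add ((hre.smul (hF1 (0, 1))).add (him.smul (hF1 (0, Complex.I))))
  have hR := ((MθCLM θ).hasFDerivAt.comp_hasDerivAt (0 : ℝ)
    ((hQ1 (0, 1)).add ((hQ1 (0, Complex.I)).const_mul Complex.I))).neg
  have hcongr := hL.unique (hR.congr_of_eventuallyEq (Filter.Eventually.of_forall fun r => by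
    have := hmom (z + r • h)
    simpa [← MθCLM_apply] using this))
  simpa [← MθCLM_apply] using hcongr

/-- The equation satisfied by `∂_x v + i ∂_y v` along the flow of `v`. -/
lemma wirt_transport {θ t : ℝ} {Q : ℝ × ℂ → ℝ} (hF : ContDiff ℝ (⊤ : ℕ∞) F)
    (hQ : ContDiff ℝ (⊤ : ℕ∞) Q)
    (hmom : ∀ z, fderiv ℝ F (t, z) (1, 0) + ((F (t, z)).re • fderiv ℝ F (t, z) (0, 1)
      + (F (t, z)).im • fderiv ℝ F (t, z) (0, Complex.I))
      = - Mθ θ ((fderiv ℝ Q (t, z) (0, 1) : ℂ)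
        + Complex.I * (fderiv ℝ Q (t, z) (0, Complex.I) : ℂ))) (z : ℂ) :
    fderiv ℝ (wirt F) (t, z) (1, F (t, z))
      = - Mθ θ ((fderiv ℝ (fun p => fderiv ℝ Q p (0, 1)) (t, z) (0, 1)
          + fderiv ℝ (fun p => fderiv ℝ Q p (0, Complex.I)) (t, z) (0, Complex.I) : ℝ) : ℂ)
        - ((fderiv ℝ F (t, z) (0, 1)).re + (fderiv ℝ F (t, z) (0, Complex.I)).im : ℝ)
          * wirt F (t, z) := by
  have hx := fderiv_momentum hF hQ hmom z 1
  have hy := fderiv_momentum hF hQ hmom z Complex.I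
  have hdir : ((1 : ℝ), F (t, z)) = (1, 0) + ((F (t, z)).re • ((0 : ℝ), (1 : ℂ))
      + (F (t, z)).im • ((0 : ℝ), Complex.I)) := by
    ext <;> simp
  rw [hdir, map_add, map_add, map_smul, map_smul, fderiv_wirt hF, fderiv_wirt hF, fderiv_wirt hF,
    fderiv_fderiv_apply_comm hF _ (0, 1) (1, 0),
    fderiv_fderiv_apply_comm hF _ (0, Complex.I) (1, 0),
    fderiv_fderiv_apply_comm hF _ (0, Complex.I) (0, 1)]
  rw [fderiv_fderiv_apply_comm hF _ (0, Complex.I) (0, 1),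
    fderiv_fderiv_apply_comm hQ _ (0, Complex.I) (0, 1)] at hx
  simp only [wirt, Mθ] at hx hy ⊢
  generalize fderiv ℝ F (t, z) (0, 1) = A at *
  generalize fderiv ℝ F (t, z) (0, Complex.I) = B at *
  simp only [Complex.real_smul, map_add, map_mul, Complex.conj_I, Complex.conj_ofReal] at hx hy ⊢
  have hAB : (A.re * A + A.im * B) + Complex.I * (B.re * A + B.im * B)
      = ((A.re + B.im : ℝ) : ℂ) * (A + Complex.I * B) := by
    apply Complex.ext <;> simp <;> ring
  push_cast at hAB ⊢
  linear_combination hx + Complex.I * hy - hAB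
    + Complex.exp (θ * Complex.I)
      * fderiv ℝ (fun p => fderiv ℝ Q p (0, Complex.I)) (t, z) (0, Complex.I) * Complex.I_sq

end Wirtinger

/-- Existence of characteristics of a bounded Lipschitz field on the whole time interval,
ending at a prescribed point. -/
lemma exists_characteristic {E : Type*} [NormedAddCommGroup E] [NormedSpace ℝ E] [CompleteSpace E]
    {v : ℝ → E → E} {t M : ℝ} (ht : 0 ≤ t)
    (hcont : ∀ x, Continuous fun s => v s x)
    (hdiff : ∀ s, Differentiable ℝ (v s))
    (hbdd : ∀ s ∈ Set.Icc 0 t, ∀ x, ‖v s x‖ ≤ M ∧ ‖fderiv ℝ (v s) x‖ ≤ M) (x : E) :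
    ∃ X : ℝ → E, X t = x ∧
      ∀ s ∈ Set.Icc 0 t, HasDerivWithinAt X (v s (X s)) (Set.Icc 0 t) s := by
  have hM : 0 ≤ M := (norm_nonneg _).trans (hbdd t ⟨ht, le_rfl⟩ x).1
  have hPL : IsPicardLindelof v (⟨t, ht, le_rfl⟩ : Set.Icc 0 t) x (M.toNNReal * t.toNNReal) 0
      M.toNNReal M.toNNReal := by
    refine ⟨fun s hs => ?_, fun y _ => (hcont y).continuousOn, fun s hs y _ => ?_, ?_⟩
    · refine (lipschitzWith_of_nnnorm_fderiv_le (hdiff s) fun y => ?_).lipschitzOnWith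
      rw [← NNReal.coe_le_coe]
      simpa [hM] using (hbdd s hs y).2
    · simpa [hM] using (hbdd s hs y).1
    · simp [ht, hM]
  exact hPL.exists_eq_forall_mem_Icc_hasDerivWithinAt₀

/-- the velocity formulation implies the vorticity formulation.  If a
smooth, bounded velocity `v` (with uniformly bounded first-order spatial derivatives)
and a smooth pressure-type function `q` satisfy `∂_t v + (v·∇)v = −M_θ∇q`,
`−Δq = div(v)·div(M_θ v)`, `curl(M_θ v)(0,·) = 0` and `div(M_θ v)(0,·) = ω₀`, then
`curl(M_θ v)(t,·) = 0` for all `t ∈ [0,T]` and `ω := div(M_θ v)` solves the transport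
equation `∂_t ω + v·∇ω = 0` with `ω(0,·) = ω₀`. -/
theorem velocity_implies_vorticity
    (T θ : ℝ) (hT : 0 < T) (hθ : θ ∈ Set.Icc (0 : ℝ) (2 * Real.pi))
    (v : ℝ → ℂ → ℂ) (q : ℝ → ℂ → ℝ) (ω₀ : ℂ → ℝ)
    (hω₀smooth : ContDiff ℝ (⊤ : ℕ∞) ω₀) (hω₀supp : HasCompactSupport ω₀)
    (hv : ContDiff ℝ (⊤ : ℕ∞) (fun p : ℝ × ℂ => v p.1 p.2))
    (hq : ContDiff ℝ (⊤ : ℕ∞) (fun p : ℝ × ℂ => q p.1 p.2))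
    (hbdd : ∃ M : ℝ, ∀ t ∈ Set.Icc (0 : ℝ) T, ∀ z : ℂ,
      ‖v t z‖ ≤ M ∧ ‖fderiv ℝ (v t) z‖ ≤ M)
    (hmom : ∀ t ∈ Set.Icc (0 : ℝ) T, ∀ z : ℂ,
      deriv (fun s => v s z) t + convDeriv (v t) (v t) z = - Mθ θ (gradC (q t) z))
    (hpress : ∀ t ∈ Set.Icc (0 : ℝ) T, ∀ z : ℂ,
      - lapl (q t) z = divOp (v t) z * divOp (fun w => Mθ θ (v t w)) z)
    (hcurl₀ : ∀ z : ℂ, curlOp (fun w => Mθ θ (v 0 w)) z = 0)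
    (hdiv₀ : ∀ z : ℂ, divOp (fun w => Mθ θ (v 0 w)) z = ω₀ z) :
    (∀ t ∈ Set.Icc (0 : ℝ) T, ∀ z : ℂ, curlOp (fun w => Mθ θ (v t w)) z = 0) ∧
    (∀ t ∈ Set.Icc (0 : ℝ) T, ∀ z : ℂ,
      deriv (fun s => divOp (fun w => Mθ θ (v s w)) z) t
        + (v t z).re * fderiv ℝ (fun w => divOp (fun u => Mθ θ (v t u)) w) z 1
        + (v t z).im * fderiv ℝ (fun w => divOp (fun u => Mθ θ (v t u)) w) z Complex.I
        = 0) ∧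
    (∀ z : ℂ, divOp (fun w => Mθ θ (v 0 w)) z = ω₀ z) := by
  obtain ⟨M, hM⟩ := hbdd
  set F : ℝ × ℂ → ℂ := fun p => v p.1 p.2
  set Q : ℝ × ℂ → ℝ := fun p => q p.1 p.2
  have hFd : Differentiable ℝ F := hv.differentiable (by simp)
  have hQd : Differentiable ℝ Q := hq.differentiable (by simp)
  have hWd : Differentiable ℝ (wirt F) := (contDiff_wirt hv).differentiable (by simp)
  have hvx (t : ℝ) (z h : ℂ) : fderiv ℝ (v t) z h = fderiv ℝ F (t, z) (0, h) :=
    fderiv_space_slice (hFd (t, z)) h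
  have hqx (t : ℝ) (z h : ℂ) : fderiv ℝ (q t) z h = fderiv ℝ Q (t, z) (0, h) :=
    fderiv_space_slice (hQd (t, z)) h
  have hcurl (t : ℝ) (z : ℂ) :
      curlOp (fun w => Mθ θ (v t w)) z = (Mθ θ (wirt F (t, z))).im :=
    curlOp_Mθ θ (hFd (t, z))
  have hdiv (t : ℝ) (z : ℂ) :
      divOp (fun w => Mθ θ (v t w)) z = (Mθ θ (wirt F (t, z))).re :=
    divOp_Mθ θ (hFd (t, z))
  have hlapl (t : ℝ) (z : ℂ) : lapl (q t) z
      = fderiv ℝ (fun p => fderiv ℝ Q p (0, 1)) (t, z) (0, 1)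
        + fderiv ℝ (fun p => fderiv ℝ Q p (0, Complex.I)) (t, z) (0, Complex.I) := by
    have hQ1 (a : ℝ × ℂ) := (contDiff_fderiv_apply_const hq a).differentiable (by simp) (t, z)
    simp only [lapl, hqx]
    rw [fderiv_space_slice (hQ1 (0, 1)), fderiv_space_slice (hQ1 (0, Complex.I))]
  have key : ∀ t ∈ Set.Icc (0 : ℝ) T, ∀ z : ℂ,
      Mθ θ (fderiv ℝ (wirt F) (t, z) (1, v t z))
        = (divOp (v t) z * (Mθ θ (wirt F (t, z))).re : ℝ)
          - (divOp (v t) z : ℂ) * Mθ θ (wirt F (t, z)) := by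
    intro t ht z
    have hW := wirt_transport (θ := θ) (t := t) hv hq (fun z => by
      have := hmom t ht z
      rw [(hasDerivAt_time_slice (hFd (t, z))).deriv] at this
      simpa only [convDeriv, gradC, hvx, hqx] using this) z
    rw [← hlapl, ← hvx, ← hvx] at hW
    have hp := hpress t ht z
    rw [hdiv] at hp
    rw [← hp, hW, ← MθCLM_apply, ← MθCLM_apply, map_sub, map_neg, ← Complex.real_smul, map_smul,
      MθCLM_apply, MθCLM_apply, MθCLM_apply, Mθ_Mθ, Complex.real_smul]
    simp [divOp]
  have hG (p : ℝ × ℂ) : HasFDerivAt (fun p => Mθ θ (wirt F p))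
      ((MθCLM θ).comp (fderiv ℝ (wirt F) p)) p := by
    simp only [← MθCLM_apply]
    exact (MθCLM θ).hasFDerivAt.comp p (hWd p).hasFDerivAt
  refine ⟨fun t ht z => ?_, fun t ht z => ?_, hdiv₀⟩
  · obtain ⟨X, hXt, hX⟩ := exists_characteristic (v := v) (M := M) ht.1
      (fun x => hv.continuous.comp (by fun_prop : Continuous fun s : ℝ => (s, x)))
      (fun s => hFd.comp (by fun_prop : Differentiable ℝ fun w : ℂ => (s, w)))
      (fun s hs x => hM s ⟨hs.1, hs.2.trans ht.2⟩ x) z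
    have hg : ∀ s ∈ Set.Icc 0 t, HasDerivWithinAt (fun s => (Mθ θ (wirt F (s, X s))).im)
        (-(divOp (v s) (X s) * (Mθ θ (wirt F (s, X s))).im)) (Set.Icc 0 t) s := by
      intro s hs
      have h1 := (Complex.imCLM.hasFDerivAt.comp _ (hG (s, X s))).comp_hasDerivWithinAt
        (f := fun s => (s, X s)) s ((hasDerivWithinAt_id s (Set.Icc 0 t)).prodMk (hX s hs))
      refine h1.congr_deriv ?_
      have h2 := congrArg Complex.im (key s ⟨hs.1, hs.2.trans ht.2⟩ (X s))
      simpa [MθCLM_apply] using h2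
    have hzero := eq_zero_of_abs_deriv_le_mul_abs_self_of_eq_zero_right (K := 2 * M)
      (fun s hs => (hg s hs).continuousWithinAt)
      (fun s hs => (hg s ⟨hs.1, hs.2.le⟩).mono_of_mem_nhdsWithin (Icc_mem_nhdsGE_of_mem hs))
      (by rw [← hcurl]; exact hcurl₀ _) (fun s hs => by
        have hb := (hM s ⟨hs.1, hs.2.le.trans ht.2⟩ (X s)).2
        have h1 := (fderiv ℝ (v s) (X s)).le_of_opNorm_le hb 1
        have hI := (fderiv ℝ (v s) (X s)).le_of_opNorm_le hb Complex.I
        have h1' := (Complex.abs_re_le_norm _).trans h1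
        have hI' := (Complex.abs_im_le_norm _).trans hI
        rw [norm_one, mul_one] at h1'
        rw [Complex.norm_I, mul_one] at hI'
        rw [norm_neg, norm_mul]
        refine mul_le_mul_of_nonneg_right ?_ (norm_nonneg _)
        rw [Real.norm_eq_abs, divOp]
        exact (abs_add_le _ _).trans (by linarith)) t ⟨ht.1, le_rfl⟩
    rw [hcurl, ← hXt]
    exact hzero
  · have hH (p : ℝ × ℂ) : HasFDerivAt (fun p => (Mθ θ (wirt F p)).re)
        (Complex.reCLM.comp ((MθCLM θ).comp (fderiv ℝ (wirt F) p))) p :=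
      Complex.reCLM.hasFDerivAt.comp p (hG p)
    have hHd := (hH (t, z)).differentiableAt
    have hdir : ((1 : ℝ), v t z) = (1, 0) + (v t z).re • ((0 : ℝ), (1 : ℂ))
        + (v t z).im • ((0 : ℝ), Complex.I) := by
      ext <;> simp
    have h2 := congrArg Complex.re (key t ht z)
    rw [hdir, map_add, map_add, map_smul, map_smul, ← MθCLM_apply] at h2
    simp only [hdiv]
    rw [(hasDerivAt_time_slice hHd).deriv, fderiv_space_slice hHd, fderiv_space_slice hHd,
      (hH (t, z)).fderiv]
    simpa [-Complex.real_smul, Complex.smul_re] using h2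
end
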